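/- arXiv:math-ph/0607058 — 8 statements merged into one kernel-verified Lean document; each statement's English description precedes it below -/
import Mathlib

section
/- Let A, B : ℝ → ℝ be C² functions, let g : ℝ² → ℝ be C² and β : ℝ² → ℝ be C². Suppose that for all (x,y) ∈ ℝ²: ∂β/∂y = A(x)·∂g/∂x + (g/2)·A'(x) and ∂β/∂x = B(y)·∂g/∂y + (g/2)·B'(y). Then g satisfies g·(A''(x) − B''(y)) − 3B'(y)·∂g/∂y − 2B(y)·∂²g/∂y² + 3A'(x)·∂g/∂x + 2A(x)·∂²g/∂x² = 0 for all (x,y) ∈ ℝ². -/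
theorem hasDerivAt_slice_fst {F : Type*} [NormedAddCommGroup F] [NormedSpace ℝ F]
    {f : ℝ × ℝ → F} {x y : ℝ} (hf : DifferentiableAt ℝ f (x, y)) :
    HasDerivAt (fun x' : ℝ => f (x', y)) (fderiv ℝ f (x, y) (1, 0)) x :=
  hf.hasFDerivAt.comp_hasDerivAt x ((hasDerivAt_id x).prodMk (hasDerivAt_const x y))

theorem hasDerivAt_slice_snd {F : Type*} [NormedAddCommGroup F] [NormedSpace ℝ F]
    {f : ℝ × ℝ → F} {x y : ℝ} (hf : DifferentiableAt ℝ f (x, y)) :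
    HasDerivAt (fun y' : ℝ => f (x, y')) (fderiv ℝ f (x, y) (0, 1)) y :=
  hf.hasFDerivAt.comp_hasDerivAt y ((hasDerivAt_const y x).prodMk (hasDerivAt_id y))

/-- Mixed second partial derivatives of a `C²` function on the plane agree. -/
theorem deriv_deriv_slice_comm {F : Type*} [NormedAddCommGroup F] [NormedSpace ℝ F]
    {f : ℝ × ℝ → F} (hf : ContDiff ℝ 2 f) (x y : ℝ) :
    deriv (fun x' : ℝ => deriv (fun y' : ℝ => f (x', y')) y) x =
      deriv (fun y' : ℝ => deriv (fun x' : ℝ => f (x', y')) x) y := by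
  have hd : Differentiable ℝ f := hf.differentiable (by norm_num)
  have hd' : Differentiable ℝ (fderiv ℝ f) :=
    (hf.fderiv_right (m := 1) (by norm_num)).differentiable (by norm_num)
  simp only [fun a b => (hasDerivAt_slice_snd (hd (a, b))).deriv,
    fun a b => (hasDerivAt_slice_fst (hd (a, b))).deriv]
  have e1 := (hasDerivAt_slice_fst (hd' (x, y))).clm_apply (hasDerivAt_const x ((0, 1) : ℝ × ℝ))
  have e2 := (hasDerivAt_slice_snd (hd' (x, y))).clm_apply (hasDerivAt_const y ((1, 0) : ℝ × ℝ))
  rw [e1.deriv, e2.deriv, map_zero, add_zero, add_zero]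
  exact hf.contDiffAt.isSymmSndFDerivAt (by simp) (1, 0) (0, 1)

/-- The derivative of `a u' + (u / 2) a'` for `C²` functions `a` and `u` of one variable. -/
theorem deriv_mul_deriv_add_half_mul_deriv {a u : ℝ → ℝ} (ha : ContDiff ℝ 2 a)
    (hu : ContDiff ℝ 2 u) (t : ℝ) :
    deriv (fun s => a s * deriv u s + u s / 2 * deriv a s) t =
      3 / 2 * deriv a t * deriv u t + a t * deriv (deriv u) t + u t / 2 * deriv (deriv a) t := by
  have key : ∀ {v : ℝ → ℝ}, ContDiff ℝ 2 v →
      HasDerivAt v (deriv v t) t ∧ HasDerivAt (deriv v) (deriv (deriv v) t) t := fun hv =>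
    ⟨(hv.differentiable (by norm_num) t).hasDerivAt,
      (hv.differentiable_deriv_two t).hasDerivAt⟩
  obtain ⟨ha1, ha2⟩ := key ha
  obtain ⟨hu1, hu2⟩ := key hu
  have h := (ha1.mul hu2).add ((hu1.div_const 2).mul ha2)
  refine h.deriv.trans ?_
  ring

/-- If `β` satisfies `β_y = A g_x + (g/2) A'` and `β_x = B g_y + (g/2) B'`,
then the metric coefficient `g` satisfies the metric equation
`g (A'' − B'') − 3 B' g_y − 2 B g_yy + 3 A' g_x + 2 A g_xx = 0`. -/
theorem stmt_6 (A B : ℝ → ℝ) (hA : ContDiff ℝ 2 A) (hB : ContDiff ℝ 2 B)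
    (g β : ℝ × ℝ → ℝ) (hg : ContDiff ℝ 2 g) (hβ : ContDiff ℝ 2 β)
    (h1 : ∀ x y : ℝ,
      deriv (fun y' : ℝ => β (x, y')) y =
        A x * deriv (fun x' : ℝ => g (x', y)) x + g (x, y) / 2 * deriv A x)
    (h2 : ∀ x y : ℝ,
      deriv (fun x' : ℝ => β (x', y)) x =
        B y * deriv (fun y' : ℝ => g (x, y')) y + g (x, y) / 2 * deriv B y) :
    ∀ x y : ℝ,
      g (x, y) * (deriv (deriv A) x - deriv (deriv B) y) -
        3 * deriv B y * deriv (fun y' : ℝ => g (x, y')) y -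
        2 * B y * deriv (deriv (fun y' : ℝ => g (x, y'))) y +
        3 * deriv A x * deriv (fun x' : ℝ => g (x', y)) x +
        2 * A x * deriv (deriv (fun x' : ℝ => g (x', y))) x = 0 := by
  intro x y
  have hgx : ContDiff ℝ 2 (fun x' : ℝ => g (x', y)) := hg.comp (contDiff_id.prodMk contDiff_const)
  have hgy : ContDiff ℝ 2 (fun y' : ℝ => g (x, y')) := hg.comp (contDiff_const.prodMk contDiff_id)
  have h := deriv_deriv_slice_comm hβ x y
  simp only [h1, h2] at h
  have hx := deriv_mul_deriv_add_half_mul_deriv hA hgx x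
  have hy := deriv_mul_deriv_add_half_mul_deriv hB hgy y
  linarith [hx.symm.trans (h.trans hy)]
end

section
/- Let ħ > 0, E, J ∈ ℝ, let I ⊆ ℝ be an open interval containing η₀, and let F, G, f, g : I → ℝ be continuous. Define Π(η) = J + 2∫_{η₀}^{η}(E F(η') − f(η'))dη' and suppose Π(η) > 0 for all η ∈ I; set p(η) = √(Π(η)). Define complex-valued functions A(η) = exp[−∫_{η₀}^{η} (−ħ f(η') + Eħ F(η') − i(−g(η') + E G(η'))p(η'))/(ħ Π(η')) dη'] and B(η) = exp[−∫_{η₀}^{η} (−ħ f(η') + Eħ F(η') + i(−g(η') + E G(η'))p(η'))/(ħ Π(η')) dη'], and set Ψ(ξ,η) = A(η) e^{iξ p(η)/ħ} + B(η) e^{−iξ p(η)/ħ}. Then for all ξ ∈ ℝ and η ∈ I: −ħ² Ψ_{ξη} + (f(η)ξ + g(η))Ψ = E(F(η)ξ + G(η))Ψ and −ħ² Ψ_{ξξ} = Π(η)Ψ. -/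
open Set intervalIntegral in
/-- Fundamental theorem of calculus on an open interval for a continuous integrand. -/
theorem hasDerivAt_integral_of_continuousOn_isOpen {V : Type*} [NormedAddCommGroup V]
    [NormedSpace ℝ V] [CompleteSpace V] {I : Set ℝ} (hIopen : IsOpen I)
    (hIconn : I.OrdConnected) {h : ℝ → V} (hh : ContinuousOn h I) {a x : ℝ} (ha : a ∈ I)
    (hx : x ∈ I) : HasDerivAt (fun y => ∫ t in a..y, h t) (h x) x :=
  integral_hasDerivAt_right ((hh.mono (hIconn.uIcc_subset ha hx)).intervalIntegrable)
    (hh.stronglyMeasurableAtFilter hIopen x hx) (hh.continuousAt (hIopen.mem_nhds hx))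

/-- The derivative in `x` of the plane wave `exp (c x)`, with amplitude `C`. -/
theorem hasDerivAt_const_mul_exp_ofReal (C c : ℂ) (x : ℝ) :
    HasDerivAt (fun x : ℝ => C * Complex.exp (c * x)) (C * c * Complex.exp (c * x)) x := by
  have h := (((Complex.ofRealCLM.hasDerivAt (x := x)).const_mul c).cexp).const_mul C
  refine h.congr_deriv ?_
  simp only [Complex.ofRealCLM_apply, Complex.ofReal_one]
  ring

/-- The mixed second derivative of a wave `C exp (c x p / ħ)`, where `c ^ 2 = -1` and the
logarithmic derivative of `C` is `-(ħ a - c b p) / (ħ p ^ 2)` and `p p' = a`. -/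
theorem hasDerivAt_wave {hbar a b x y : ℝ} (hhbar : hbar ≠ 0) {c : ℂ} (hc : c ^ 2 = -1)
    {p : ℝ → ℝ} (hp0 : p y ≠ 0) (hp : HasDerivAt p (a / p y) y) {C : ℝ → ℂ}
    (hC : HasDerivAt C (C y * -((hbar * a - c * (b * p y)) / (hbar * (p y) ^ 2))) y) :
    HasDerivAt (fun y => C y * (c * p y / hbar) * Complex.exp (c * p y / hbar * x))
      (-(a * x + b) / hbar ^ 2 * (C y * Complex.exp (c * p y / hbar * x))) y := by
  have hk : HasDerivAt (fun y => c * (p y : ℂ) / hbar) (c * ((a / p y : ℝ) : ℂ) / hbar) y :=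
    (hp.ofReal_comp.const_mul c).div_const _
  refine ((hC.mul hk).mul (hk.mul_const (x : ℂ)).cexp).congr_deriv ?_
  have h1 : (hbar : ℂ) ≠ 0 := by exact_mod_cast hhbar
  have h2 : (p y : ℂ) ≠ 0 := by exact_mod_cast hp0
  generalize Complex.exp (c * p y / hbar * x) = e
  simp only [Pi.mul_apply]
  push_cast
  field_simp
  linear_combination (C y * e * p y * (b + a * x)) * hc

/-- WKB-like explicit solution of a Lie integrable quantum system in the
oscillatory case `Π(η) > 0`: the function
`Ψ(ξ,η) = A(η)e^{iξp(η)/ħ} + B(η)e^{−iξp(η)/ħ}` satisfies the Schrödinger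
equation (multiplied by the metric) and the reduced integral equation. -/
theorem stmt_13 (hbar : ℝ) (hhbar : 0 < hbar) (E J η₀ : ℝ)
    (I : Set ℝ) (hIopen : IsOpen I) (hIconn : I.OrdConnected) (hη₀ : η₀ ∈ I)
    (F G f g : ℝ → ℝ) (hF : ContinuousOn F I) (hG : ContinuousOn G I)
    (hf : ContinuousOn f I) (hg : ContinuousOn g I)
    (Pi : ℝ → ℝ)
    (hPi : ∀ η : ℝ, Pi η = J + 2 * ∫ t in η₀..η, (E * F t - f t))
    (hPipos : ∀ η ∈ I, 0 < Pi η)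
    (p : ℝ → ℝ) (hp : ∀ η : ℝ, p η = Real.sqrt (Pi η))
    (A B : ℝ → ℂ)
    (hA : ∀ η : ℝ, A η = Complex.exp (-(∫ t in η₀..η,
        (((-(hbar * f t) + E * hbar * F t : ℝ) : ℂ) -
            Complex.I * (((-(g t) + E * G t) * p t : ℝ) : ℂ)) /
          ((hbar * Pi t : ℝ) : ℂ))))
    (hB : ∀ η : ℝ, B η = Complex.exp (-(∫ t in η₀..η,
        (((-(hbar * f t) + E * hbar * F t : ℝ) : ℂ) +
            Complex.I * (((-(g t) + E * G t) * p t : ℝ) : ℂ)) /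
          ((hbar * Pi t : ℝ) : ℂ))))
    (Ψ : ℝ → ℝ → ℂ)
    (hΨ : ∀ ξ η : ℝ, Ψ ξ η =
        A η * Complex.exp (Complex.I * (ξ : ℂ) * ((p η : ℝ) : ℂ) / (hbar : ℂ)) +
        B η * Complex.exp (-(Complex.I * (ξ : ℂ) * ((p η : ℝ) : ℂ) / (hbar : ℂ)))) :
    ∀ ξ : ℝ, ∀ η ∈ I,
      (-(hbar ^ 2 : ℂ) * deriv (fun y : ℝ => deriv (fun x : ℝ => Ψ x y) ξ) η +
          ((f η * ξ + g η : ℝ) : ℂ) * Ψ ξ η =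
        ((E : ℝ) : ℂ) * ((F η * ξ + G η : ℝ) : ℂ) * Ψ ξ η) ∧
      (-(hbar ^ 2 : ℂ) * deriv (deriv (fun x : ℝ => Ψ x η)) ξ =
        ((Pi η : ℝ) : ℂ) * Ψ ξ η) := by
  intro ξ η hη
  have hh : hbar ≠ 0 := hhbar.ne'
  have hhC : (hbar : ℂ) ≠ 0 := by exact_mod_cast hh
  have hPi_deriv : ∀ y ∈ I, HasDerivAt Pi (2 * (E * F y - f y)) y := by
    intro y hy
    rw [funext hPi]
    exact ((hasDerivAt_integral_of_continuousOn_isOpen hIopen hIconn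
      ((hF.const_mul E).sub hf) hη₀ hy).const_mul 2).const_add J
  have hp_pos : ∀ y ∈ I, 0 < p y := fun y hy => by
    rw [hp]; exact Real.sqrt_pos.2 (hPipos y hy)
  have hp_sq : ∀ y ∈ I, p y ^ 2 = Pi y := fun y hy => by
    rw [hp]; exact Real.sq_sqrt (hPipos y hy).le
  have hp_deriv : ∀ y ∈ I, HasDerivAt p ((E * F y - f y) / p y) y := by
    intro y hy
    have h := (hPi_deriv y hy).sqrt (hPipos y hy).ne'
    rw [← funext hp, ← hp y] at h
    exact h.congr_deriv (by rw [mul_div_mul_left _ _ two_ne_zero])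
  have hPi_cont : ContinuousOn Pi I := fun y hy =>
    (hPi_deriv y hy).continuousAt.continuousWithinAt
  have hp_cont : ContinuousOn p I := fun y hy =>
    (hp_deriv y hy).continuousAt.continuousWithinAt
  have hden : ∀ t ∈ I, ((hbar * Pi t : ℝ) : ℂ) ≠ 0 := fun t ht => by
    exact_mod_cast (mul_pos hhbar (hPipos t ht)).ne'
  have hre : ContinuousOn (fun t => ((-(hbar * f t) + E * hbar * F t : ℝ) : ℂ)) I :=
    Complex.continuous_ofReal.comp_continuousOn (by fun_prop)
  have him : ContinuousOn (fun t => Complex.I * (((-(g t) + E * G t) * p t : ℝ) : ℂ)) I :=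
    continuousOn_const.mul (Complex.continuous_ofReal.comp_continuousOn (by fun_prop))
  have hdc : ContinuousOn (fun t => ((hbar * Pi t : ℝ) : ℂ)) I :=
    Complex.continuous_ofReal.comp_continuousOn (by fun_prop)
  have hA_deriv := (hasDerivAt_integral_of_continuousOn_isOpen hIopen hIconn
    ((hre.sub him).div hdc hden) hη₀ hη).neg.cexp
  have hB_deriv := (hasDerivAt_integral_of_continuousOn_isOpen hIopen hIconn
    ((hre.add him).div hdc hden) hη₀ hη).neg.cexp
  have hA' : HasDerivAt A (A η * -((hbar * (E * F η - f η : ℝ) -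
      Complex.I * ((E * G η - g η : ℝ) * p η)) / (hbar * (p η) ^ 2))) η := by
    have hPiC : ((Pi η : ℝ) : ℂ) = (p η : ℂ) ^ 2 := by exact_mod_cast (hp_sq η hη).symm
    rw [hA η, funext hA]
    refine hA_deriv.congr_deriv ?_
    simp only [_root_.Pi.neg_apply, _root_.Pi.sub_apply, _root_.Pi.div_apply]
    congr 2
    push_cast
    rw [hPiC]
    ring
  have hB' : HasDerivAt B (B η * -((hbar * (E * F η - f η : ℝ) -
      (-Complex.I) * ((E * G η - g η : ℝ) * p η)) / (hbar * (p η) ^ 2))) η := by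
    have hPiC : ((Pi η : ℝ) : ℂ) = (p η : ℂ) ^ 2 := by exact_mod_cast (hp_sq η hη).symm
    rw [hB η, funext hB]
    refine hB_deriv.congr_deriv ?_
    simp only [_root_.Pi.neg_apply, _root_.Pi.add_apply, _root_.Pi.div_apply]
    congr 2
    push_cast
    rw [hPiC]
    ring
  have hΨ' : ∀ x y : ℝ, Ψ x y = A y * Complex.exp (Complex.I * p y / hbar * x) +
      B y * Complex.exp (-Complex.I * p y / hbar * x) := by
    intro x y
    rw [hΨ]
    congr 3 <;> ring
  have hΨx : ∀ y : ℝ, deriv (fun x : ℝ => Ψ x y) = fun x : ℝ =>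
      A y * (Complex.I * p y / hbar) * Complex.exp (Complex.I * p y / hbar * x) +
      B y * (-Complex.I * p y / hbar) * Complex.exp (-Complex.I * p y / hbar * x) := by
    intro y
    funext x
    simp only [hΨ']
    exact ((hasDerivAt_const_mul_exp_ofReal _ _ x).add
      (hasDerivAt_const_mul_exp_ofReal _ _ x)).deriv
  have hΨxy := ((hasDerivAt_wave (x := ξ) hh Complex.I_sq (hp_pos η hη).ne'
    (hp_deriv η hη) hA').add (hasDerivAt_wave (x := ξ) hh (by rw [neg_sq, Complex.I_sq])
    (hp_pos η hη).ne' (hp_deriv η hη) hB')).deriv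
  have hΨxx := ((hasDerivAt_const_mul_exp_ofReal (A η * (Complex.I * p η / hbar))
    (Complex.I * p η / hbar) ξ).add (hasDerivAt_const_mul_exp_ofReal
    (B η * (-Complex.I * p η / hbar)) (-Complex.I * p η / hbar) ξ)).deriv
  constructor
  · simp only [hΨx]
    refine (congrArg (fun z => -(hbar ^ 2 : ℂ) * z +
      ((f η * ξ + g η : ℝ) : ℂ) * Ψ ξ η) hΨxy).trans ?_
    simp only [hΨ']
    push_cast
    field_simp
    ring
  · rw [hΨx]
    refine (congrArg (fun z => -(hbar ^ 2 : ℂ) * z) hΨxx).trans ?_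
    simp only [hΨ', ← hp_sq η hη]
    generalize Complex.exp (Complex.I * p η / hbar * ξ) = e₁
    generalize Complex.exp (-Complex.I * p η / hbar * ξ) = e₂
    push_cast
    field_simp
    linear_combination (-(p η : ℂ) ^ 2 * (A η * e₁ + B η * e₂)) * Complex.I_sq
end

section
/- Let ħ > 0, E, J ∈ ℝ, let I ⊆ ℝ be an open interval containing η₀, and let F, G, f, g : I → ℝ be continuous. Define Π(η) = J + 2∫_{η₀}^{η}(E F(η') − f(η'))dη' and suppose Π(η) < 0 for all η ∈ I; set p(η) = √(−Π(η)). Define a(η) = exp[−∫_{η₀}^{η} (−ħ f(η') + Eħ F(η') − (−g(η') + E G(η'))p(η'))/(ħ Π(η')) dη'] and b(η) = exp[−∫_{η₀}^{η} (−ħ f(η') + Eħ F(η') + (−g(η') + E G(η'))p(η'))/(ħ Π(η')) dη'], and set Ψ(ξ,η) = a(η) e^{ξ p(η)/ħ} + b(η) e^{−ξ p(η)/ħ}. Then for all ξ ∈ ℝ and η ∈ I: −ħ² Ψ_{ξη} + (f(η)ξ + g(η))Ψ = E(F(η)ξ + G(η))Ψ and −ħ² Ψ_{ξξ} = Π(η)Ψ.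 -/
/-- The fundamental theorem of calculus for a continuous function on an open interval. -/
theorem hasDerivAt_integral_of_continuousOn_ordConnected {I : Set ℝ} (hI : IsOpen I)
    (hconn : I.OrdConnected) {h : ℝ → ℝ} (hh : ContinuousOn h I) {x₀ x : ℝ} (hx₀ : x₀ ∈ I)
    (hx : x ∈ I) : HasDerivAt (fun y => ∫ t in x₀..y, h t) (h x) x :=
  intervalIntegral.integral_hasDerivAt_right
    (hh.mono (hconn.uIcc_subset hx₀ hx)).intervalIntegrable
    (hh.stronglyMeasurableAtFilter hI x hx) (hh.continuousAt (hI.mem_nhds hx))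

/-- The derivative in `ξ` of a combination of the exponentials `exp (± ξ q / c)`. -/
theorem deriv_exp_add_exp_neg (A B q c ξ : ℝ) :
    deriv (fun x => A * Real.exp (x * q / c) + B * Real.exp (-(x * q / c))) ξ =
      A * (q / c) * Real.exp (ξ * q / c) + -(B * (q / c)) * Real.exp (-(ξ * q / c)) := by
  have h : HasDerivAt (fun x : ℝ => x * q / c) (q / c) ξ := by
    simpa using ((hasDerivAt_id ξ).mul_const q).div_const c
  refine ((h.exp.const_mul A).add (h.neg.exp.const_mul B)).deriv.trans ?_
  simp only [Pi.neg_apply]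
  ring

/-- WKB-like explicit solution of a Lie integrable quantum system in the
exponential case `Π(η) < 0`: the function
`Ψ(ξ,η) = a(η)e^{ξp(η)/ħ} + b(η)e^{−ξp(η)/ħ}` satisfies the Schrödinger
equation (multiplied by the metric) and the reduced integral equation. -/
theorem stmt_14 (hbar : ℝ) (hhbar : 0 < hbar) (E J η₀ : ℝ)
    (I : Set ℝ) (hIopen : IsOpen I) (hIconn : I.OrdConnected) (hη₀ : η₀ ∈ I)
    (F G f g : ℝ → ℝ) (hF : ContinuousOn F I) (hG : ContinuousOn G I)
    (hf : ContinuousOn f I) (hg : ContinuousOn g I)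
    (Pi : ℝ → ℝ)
    (hPi : ∀ η : ℝ, Pi η = J + 2 * ∫ t in η₀..η, (E * F t - f t))
    (hPineg : ∀ η ∈ I, Pi η < 0)
    (p : ℝ → ℝ) (hp : ∀ η : ℝ, p η = Real.sqrt (-Pi η))
    (a b : ℝ → ℝ)
    (ha : ∀ η : ℝ, a η = Real.exp (-(∫ t in η₀..η,
        (-(hbar * f t) + E * hbar * F t - (-(g t) + E * G t) * p t) /
          (hbar * Pi t))))
    (hb : ∀ η : ℝ, b η = Real.exp (-(∫ t in η₀..η,
        (-(hbar * f t) + E * hbar * F t + (-(g t) + E * G t) * p t) /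
          (hbar * Pi t))))
    (Ψ : ℝ → ℝ → ℝ)
    (hΨ : ∀ ξ η : ℝ, Ψ ξ η =
        a η * Real.exp (ξ * p η / hbar) + b η * Real.exp (-(ξ * p η / hbar))) :
    ∀ ξ : ℝ, ∀ η ∈ I,
      (-(hbar ^ 2) * deriv (fun y : ℝ => deriv (fun x : ℝ => Ψ x y) ξ) η +
          (f η * ξ + g η) * Ψ ξ η =
        E * (F η * ξ + G η) * Ψ ξ η) ∧
      (-(hbar ^ 2) * deriv (deriv (fun x : ℝ => Ψ x η)) ξ = Pi η * Ψ ξ η) := by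
  intro ξ η hη
  have hc : hbar ≠ 0 := hhbar.ne'
  have hdPi : ∀ y ∈ I, HasDerivAt Pi (2 * (E * F y - f y)) y := fun y hy => by
    rw [funext hPi]
    exact ((hasDerivAt_integral_of_continuousOn_ordConnected hIopen hIconn
      ((continuousOn_const.mul hF).sub hf) hη₀ hy).const_mul 2).const_add J
  have hPic : ContinuousOn Pi I := fun y hy => (hdPi y hy).continuousAt.continuousWithinAt
  have hpc : ContinuousOn p I := by
    rw [funext hp]
    exact hPic.neg.sqrt
  have hden : ∀ t ∈ I, hbar * Pi t ≠ 0 := fun t ht => mul_ne_zero hc (hPineg t ht).ne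
  have hnum : ContinuousOn (fun t => -(hbar * f t) + E * hbar * F t) I :=
    (continuousOn_const.mul hf).neg.add (continuousOn_const.mul hF)
  have hprod : ContinuousOn (fun t => (-(g t) + E * G t) * p t) I :=
    (hg.neg.add (continuousOn_const.mul hG)).mul hpc
  have hda := (hasDerivAt_integral_of_continuousOn_ordConnected hIopen hIconn
    ((hnum.sub hprod).div (continuousOn_const.mul hPic) hden) hη₀ hη).neg.exp
  have hdb := (hasDerivAt_integral_of_continuousOn_ordConnected hIopen hIconn
    ((hnum.add hprod).div (continuousOn_const.mul hPic) hden) hη₀ hη).neg.exp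
  have hda' : HasDerivAt a (a η * -((-(hbar * f η) + E * hbar * F η -
      (-(g η) + E * G η) * p η) / (hbar * Pi η))) η := by
    rw [funext ha]; exact hda
  have hdb' : HasDerivAt b (b η * -((-(hbar * f η) + E * hbar * F η +
      (-(g η) + E * G η) * p η) / (hbar * Pi η))) η := by
    rw [funext hb]; exact hdb
  have hppos : 0 < p η := by
    rw [hp]
    exact Real.sqrt_pos.2 (neg_pos.2 (hPineg η hη))
  have hPip : Pi η = -p η ^ 2 := by
    rw [hp, Real.sq_sqrt (neg_pos.2 (hPineg η hη)).le, neg_neg]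
  have hdp : HasDerivAt p (-(2 * (E * F η - f η)) / (2 * p η)) η := by
    rw [hp η, funext hp]
    exact (hdPi η hη).neg.sqrt (neg_pos.2 (hPineg η hη)).ne'
  have hp0 : p η ≠ 0 := hppos.ne'
  have hdξ : ∀ y, deriv (fun x => Ψ x y) = fun x => a y * (p y / hbar) *
      Real.exp (x * p y / hbar) + -(b y * (p y / hbar)) * Real.exp (-(x * p y / hbar)) := by
    intro y
    funext x
    simp only [hΨ]
    exact deriv_exp_add_exp_neg _ _ _ _ _
  constructor
  · have hphase := (hdp.const_mul ξ).div_const hbar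
    have hmixed := ((hda'.mul (hdp.div_const hbar)).mul hphase.exp).add
      ((hdb'.mul (hdp.div_const hbar)).neg.mul hphase.neg.exp)
    have hd := hmixed.congr_of_eventuallyEq (f₁ := fun y => deriv (fun x => Ψ x y) ξ)
      (Filter.Eventually.of_forall fun y => congrFun (hdξ y) ξ)
    rw [hd.deriv, hΨ, hPip]
    simp only [_root_.Pi.mul_apply, _root_.Pi.neg_apply]
    field_simp
    ring
  · rw [hdξ, deriv_exp_add_exp_neg, hΨ, hPip]
    field_simp
end

section
/- Let λ, κ, μ, ν ∈ ℝ and define F(u) = 4λu² + κu + ν/2 and G(v) = −λv² + μ/v² + ν/2, and let A(ξ) = ξ, B(η) = η. Then for all (ξ,η) ∈ ℝ² with ξ − η ≠ 0: (A''(ξ) − B''(η))(F(ξ+η) + G(ξ−η)) + 3A'(ξ)(F'(ξ+η) + G'(ξ−η)) − 3B'(η)(F'(ξ+η) − G'(ξ−η)) + 2(A(ξ) − B(η))(F''(ξ+η) + G''(ξ−η)) = 0. -/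
theorem hasDerivAt_quadratic (a b c x : ℝ) :
    HasDerivAt (fun u : ℝ => a * u ^ 2 + b * u + c) (2 * a * x + b) x := by
  have h := (((hasDerivAt_pow 2 x).const_mul a).add ((hasDerivAt_id x).const_mul b)).add_const c
  refine h.congr_deriv ?_
  norm_num
  ring

theorem hasDerivAt_const_div_pow (a : ℝ) (n : ℕ) {x : ℝ} (hx : x ≠ 0) :
    HasDerivAt (fun v : ℝ => a / v ^ (n + 1)) (-((n + 1) * a) / x ^ (n + 2)) x := by
  have h := (hasDerivAt_const x a).fun_div (hasDerivAt_pow (n + 1) x) (pow_ne_zero _ hx)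
  refine h.congr_deriv ?_
  push_cast
  field_simp
  ring

/-- The subclass I₁ data `A(ξ) = ξ`, `B(η) = η`,
`F(u) = 4λu² + κu + ν/2`, `G(v) = −λv² + μ/v² + ν/2` satisfy the metric
equation of a Class I superintegrable system. -/
theorem stmt_15 (lam κ μ ν : ℝ) (F G A B : ℝ → ℝ)
    (hF : ∀ u : ℝ, F u = 4 * lam * u ^ 2 + κ * u + ν / 2)
    (hG : ∀ v : ℝ, G v = -lam * v ^ 2 + μ / v ^ 2 + ν / 2)
    (hA : ∀ ξ : ℝ, A ξ = ξ) (hB : ∀ η : ℝ, B η = η) :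
    ∀ ξ η : ℝ, ξ - η ≠ 0 →
      (deriv (deriv A) ξ - deriv (deriv B) η) * (F (ξ + η) + G (ξ - η)) +
        3 * deriv A ξ * (deriv F (ξ + η) + deriv G (ξ - η)) -
        3 * deriv B η * (deriv F (ξ + η) - deriv G (ξ - η)) +
        2 * (A ξ - B η) *
          (deriv (deriv F) (ξ + η) + deriv (deriv G) (ξ - η)) = 0 := by
  have hA' : deriv A = fun _ => 1 := by
    rw [funext hA]; exact deriv_id'
  have hB' : deriv B = fun _ => 1 := by
    rw [funext hB]; exact deriv_id'
  have hF' : deriv F = fun u => 0 * u ^ 2 + 8 * lam * u + κ := by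
    funext u
    rw [funext hF, (hasDerivAt_quadratic _ _ _ u).deriv]
    ring
  have hF'' (u : ℝ) : deriv (deriv F) u = 8 * lam := by
    rw [hF', (hasDerivAt_quadratic _ _ _ u).deriv]
    ring
  have hG' {v : ℝ} (hv : v ≠ 0) : deriv G v = -2 * lam * v + -(2 * μ) / v ^ 3 := by
    have h := (hasDerivAt_quadratic (-lam) 0 (ν / 2) v).add (hasDerivAt_const_div_pow μ 1 hv)
    have hG_eq : G = (fun u : ℝ => -lam * u ^ 2 + 0 * u + ν / 2) +
        fun u : ℝ => μ / u ^ (1 + 1) := by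
      funext u
      simp only [hG, Pi.add_apply]
      ring
    rw [hG_eq, h.deriv]
    norm_num
  have hG'' {v : ℝ} (hv : v ≠ 0) : deriv (deriv G) v = -2 * lam + 6 * μ / v ^ 4 := by
    have h := (hasDerivAt_quadratic 0 (-2 * lam) 0 v).add
      (hasDerivAt_const_div_pow (-(2 * μ)) 2 hv)
    refine (h.congr_of_eventuallyEq ?_).deriv.trans ?_
    · filter_upwards [isOpen_ne.mem_nhds hv] with u hu
      rw [hG' hu]
      simp
    · norm_num
      ring
  intro ξ η hξη
  rw [hF'', hG'' hξη, hG' hξη, hA', hB', hA, hB, deriv_const']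
  field_simp
  ring
end

section
/- Let λ, κ, μ, ν ∈ ℝ and define F(u) = λu² + κ/u² + ν/2 and G(v) = −λv² + μ/v² + ν/2, and let A(ξ) = ξ², B(η) = η². Then for all (ξ,η) ∈ ℝ² with ξ + η ≠ 0 and ξ − η ≠ 0: (A''(ξ) − B''(η))(F(ξ+η) + G(ξ−η)) + 3A'(ξ)(F'(ξ+η) + G'(ξ−η)) − 3B'(η)(F'(ξ+η) − G'(ξ−η)) + 2(A(ξ) − B(η))(F''(ξ+η) + G''(ξ−η)) = 0. -/
theorem deriv_mul_sq_add_div_sq_add (a b c : ℝ) {u : ℝ} (hu : u ≠ 0) :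
    deriv (fun x : ℝ => a * x ^ 2 + b / x ^ 2 + c) u = 2 * a * u - 2 * b / u ^ 3 := by
  have h := (((hasDerivAt_pow 2 u).const_mul a).add
    (((hasDerivAt_const u b).div (hasDerivAt_pow 2 u) (pow_ne_zero 2 hu)))).add_const c
  refine (HasDerivAt.deriv h).trans ?_
  push_cast
  field_simp
  ring

theorem deriv_deriv_mul_sq_add_div_sq_add (a b c : ℝ) {u : ℝ} (hu : u ≠ 0) :
    deriv (deriv (fun x : ℝ => a * x ^ 2 + b / x ^ 2 + c)) u = 2 * a + 6 * b / u ^ 4 := by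
  have heq : deriv (fun x : ℝ => a * x ^ 2 + b / x ^ 2 + c) =ᶠ[nhds u]
      fun x => 2 * a * x - 2 * b / x ^ 3 := by
    filter_upwards [isOpen_ne.mem_nhds hu] with x hx
    exact deriv_mul_sq_add_div_sq_add a b c hx
  rw [heq.deriv_eq]
  have h := ((hasDerivAt_id u).const_mul (2 * a)).sub
    ((hasDerivAt_const u (2 * b)).div (hasDerivAt_pow 3 u) (pow_ne_zero 3 hu))
  refine (HasDerivAt.deriv h).trans ?_
  push_cast
  field_simp
  ring

theorem deriv_sq_eq : deriv (fun x : ℝ => x ^ 2) = fun x => 2 * x := by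
  ext x
  simp

/-- The subclass I₂ data `A(ξ) = ξ²`, `B(η) = η²`,
`F(u) = λu² + κ/u² + ν/2`, `G(v) = −λv² + μ/v² + ν/2` satisfy the metric
equation of a Class I superintegrable system. -/
theorem stmt_16 (lam κ μ ν : ℝ) (F G A B : ℝ → ℝ)
    (hF : ∀ u : ℝ, F u = lam * u ^ 2 + κ / u ^ 2 + ν / 2)
    (hG : ∀ v : ℝ, G v = -lam * v ^ 2 + μ / v ^ 2 + ν / 2)
    (hA : ∀ ξ : ℝ, A ξ = ξ ^ 2) (hB : ∀ η : ℝ, B η = η ^ 2) :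
    ∀ ξ η : ℝ, ξ + η ≠ 0 → ξ - η ≠ 0 →
      (deriv (deriv A) ξ - deriv (deriv B) η) * (F (ξ + η) + G (ξ - η)) +
        3 * deriv A ξ * (deriv F (ξ + η) + deriv G (ξ - η)) -
        3 * deriv B η * (deriv F (ξ + η) - deriv G (ξ - η)) +
        2 * (A ξ - B η) *
          (deriv (deriv F) (ξ + η) + deriv (deriv G) (ξ - η)) = 0 := by
  obtain rfl : F = _ := funext hF
  obtain rfl : G = _ := funext hG
  obtain rfl : A = _ := funext hA
  obtain rfl : B = _ := funext hB
  intro ξ η hu hv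
  rw [deriv_deriv_mul_sq_add_div_sq_add _ _ _ hu, deriv_deriv_mul_sq_add_div_sq_add _ _ _ hv,
    deriv_mul_sq_add_div_sq_add _ _ _ hu, deriv_mul_sq_add_div_sq_add _ _ _ hv, deriv_sq_eq]
  have hξ : deriv (fun x : ℝ => 2 * x) ξ = 2 := by simp
  have hη : deriv (fun x : ℝ => 2 * x) η = 2 := by simp
  rw [hξ, hη]
  field_simp
  ring
end

section
/- Let λ, κ, μ, ν ∈ ℝ. Define F(u) = 4λu² + κu + ν/2, G(v) = −λv² + μ/v² + ν/2, and the transformed functions F̃(u) = λu⁶/256 + κu⁴/128 + νu²/16 − μ/u² and G̃(v) = −λv⁶/256 − κv⁴/128 − νv²/16 + μ/v². Then for all ξ > 0, η > 0 with ξ ≠ η, setting X = 2√ξ and Y = 2√η, the identity F̃(X+Y) + G̃(X−Y) = √(ξη)·(F(ξ+η) + G(ξ−η)) holds. -/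
/-- Subclass I₁: under the coordinate change `X = 2√ξ`, `Y = 2√η` the metric
factor is again of Liouville form: `F̃(X+Y) + G̃(X−Y) = √(ξη)(F(ξ+η) + G(ξ−η))`. -/
theorem stmt_17 (lam κ μ ν : ℝ) (F G Ft Gt : ℝ → ℝ)
    (hF : ∀ u : ℝ, F u = 4 * lam * u ^ 2 + κ * u + ν / 2)
    (hG : ∀ v : ℝ, G v = -lam * v ^ 2 + μ / v ^ 2 + ν / 2)
    (hFt : ∀ u : ℝ, Ft u =
      lam * u ^ 6 / 256 + κ * u ^ 4 / 128 + ν * u ^ 2 / 16 - μ / u ^ 2)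
    (hGt : ∀ v : ℝ, Gt v =
      -(lam * v ^ 6) / 256 - κ * v ^ 4 / 128 - ν * v ^ 2 / 16 + μ / v ^ 2) :
    ∀ ξ η : ℝ, 0 < ξ → 0 < η → ξ ≠ η →
      Ft (2 * Real.sqrt ξ + 2 * Real.sqrt η) +
        Gt (2 * Real.sqrt ξ - 2 * Real.sqrt η) =
      Real.sqrt (ξ * η) * (F (ξ + η) + G (ξ - η)) := by
  intro ξ η hξ hη hne
  obtain ⟨a, ha, rfl⟩ : ∃ a : ℝ, 0 < a ∧ a ^ 2 = ξ :=
    ⟨√ξ, Real.sqrt_pos.2 hξ, Real.sq_sqrt hξ.le⟩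
  obtain ⟨b, hb, rfl⟩ : ∃ b : ℝ, 0 < b ∧ b ^ 2 = η :=
    ⟨√η, Real.sqrt_pos.2 hη, Real.sq_sqrt hη.le⟩
  have hadd : a + b ≠ 0 := by positivity
  have hsub : a - b ≠ 0 := fun h => hne (by rw [sub_eq_zero.1 h])
  rw [← mul_pow, Real.sqrt_sq ha.le, Real.sqrt_sq hb.le, Real.sqrt_sq (by positivity),
    hFt, hGt, hF, hG, ← mul_add, ← mul_sub, sq_sub_sq]
  field_simp
  ring
end

section
/- Let λ, κ, μ, ν ∈ ℝ. Define F(u) = λu² + κ/u² + ν/2, G(v) = −λv² + μ/v² + ν/2, and the transformed functions F̃(u) = 4λe^{2u} + νe^{u} and G̃(v) = κe^{v}/(1 + e^{v})² + μe^{v}/(e^{v} − 1)². Then for all ξ > 0, η > 0 with ξ ≠ η, setting X = ln ξ and Y = ln η, the identity F̃(X+Y) + G̃(X−Y) = ξη·(F(ξ+η) + G(ξ−η)) holds. -/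
/-- Subclass I₂: under the coordinate change `X = ln ξ`, `Y = ln η` the metric
factor is again of Liouville form: `F̃(X+Y) + G̃(X−Y) = ξη(F(ξ+η) + G(ξ−η))`. -/
theorem stmt_18 (lam κ μ ν : ℝ) (F G Ft Gt : ℝ → ℝ)
    (hF : ∀ u : ℝ, F u = lam * u ^ 2 + κ / u ^ 2 + ν / 2)
    (hG : ∀ v : ℝ, G v = -lam * v ^ 2 + μ / v ^ 2 + ν / 2)
    (hFt : ∀ u : ℝ, Ft u = 4 * lam * Real.exp (2 * u) + ν * Real.exp u)
    (hGt : ∀ v : ℝ, Gt v =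
      κ * Real.exp v / (1 + Real.exp v) ^ 2 +
        μ * Real.exp v / (Real.exp v - 1) ^ 2) :
    ∀ ξ η : ℝ, 0 < ξ → 0 < η → ξ ≠ η →
      Ft (Real.log ξ + Real.log η) + Gt (Real.log ξ - Real.log η) =
        ξ * η * (F (ξ + η) + G (ξ - η)) := by
  intro ξ η hξ hη hne
  have hsum : Real.exp (Real.log ξ + Real.log η) = ξ * η := by
    rw [Real.exp_add, Real.exp_log hξ, Real.exp_log hη]
  have hsq : Real.exp (2 * (Real.log ξ + Real.log η)) = (ξ * η) ^ 2 := by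
    rw [two_mul, Real.exp_add, hsum, sq]
  have hdiff : Real.exp (Real.log ξ - Real.log η) = ξ / η := by
    rw [Real.exp_sub, Real.exp_log hξ, Real.exp_log hη]
  have hη₀ : η ≠ 0 := hη.ne'
  have hadd : ξ + η ≠ 0 := (add_pos hξ hη).ne'
  have hsub : ξ - η ≠ 0 := sub_ne_zero.mpr hne
  have hplus : 1 + ξ / η = (ξ + η) / η := by field_simp; ring
  have hminus : ξ / η - 1 = (ξ - η) / η := by field_simp
  rw [hF, hG, hFt, hGt, hsum, hsq, hdiff, hplus, hminus]
  field_simp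
  ring
end

section
/- Let λ, κ, μ, ν ∈ ℝ. Define F(η) = κ/√η + λ and G(η) = 3κ√η + λη + μ/√η + ν, and the transformed functions F̃(u) = λu⁴/128 + κu³/16 + νu²/16 + μu/4 and G̃(v) = −λv⁴/128 + κv³/16 + μv/4 − νv²/16. Then for all ξ > 0, η > 0, setting X = 2√ξ and Y = 2√η, the identity F̃(X+Y) + G̃(X−Y) = √(ξη)·(ξ·F(η) + G(η)) holds. -/
/-- Subclass II₂: under the coordinate change `X = 2√ξ`, `Y = 2√η` the Lie-form
metric factor becomes of Liouville form:
`F̃(X+Y) + G̃(X−Y) = √(ξη)(ξF(η) + G(η))`. -/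
theorem stmt_19 (lam κ μ ν : ℝ) (F G Ft Gt : ℝ → ℝ)
    (hF : ∀ η : ℝ, F η = κ / Real.sqrt η + lam)
    (hG : ∀ η : ℝ, G η = 3 * κ * Real.sqrt η + lam * η + μ / Real.sqrt η + ν)
    (hFt : ∀ u : ℝ, Ft u =
      lam * u ^ 4 / 128 + κ * u ^ 3 / 16 + ν * u ^ 2 / 16 + μ * u / 4)
    (hGt : ∀ v : ℝ, Gt v =
      -(lam * v ^ 4) / 128 + κ * v ^ 3 / 16 + μ * v / 4 - ν * v ^ 2 / 16) :
    ∀ ξ η : ℝ, 0 < ξ → 0 < η →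
      Ft (2 * Real.sqrt ξ + 2 * Real.sqrt η) +
        Gt (2 * Real.sqrt ξ - 2 * Real.sqrt η) =
      Real.sqrt (ξ * η) * (ξ * F η + G η) := by
  intro ξ η hξ hη
  rw [hF, hG, hFt, hGt, Real.sqrt_mul hξ.le]
  have hη' : Real.sqrt η ≠ 0 := (Real.sqrt_pos.mpr hη).ne'
  have hsqξ : ξ = Real.sqrt ξ ^ 2 := (Real.sq_sqrt hξ.le).symm
  have hsqη : η = Real.sqrt η ^ 2 := (Real.sq_sqrt hη.le).symm
  generalize Real.sqrt ξ = a at *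
  generalize Real.sqrt η = b at *
  subst hsqξ hsqη
  field_simp
  ring
end
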